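/- Let F be a strongly convex Minkowski norm on ℝ^m which is of class C³ on ℝ^m ∖ {0}. Then for every ω ∈ (ℝ^m)^* with ω ≠ 0 the fundamental tensor g^*_ω(η₁,η₂) := (1/2)·D²(F^{*2})(ω)[η₁,η₂] of the dual co-Finsler norm F^* is a positive definite bilinear form on (ℝ^m)^*; in other words, F^* is itself a strongly convex Minkowski norm on the dual space. -/

import Mathlib

open scoped Topology Classical
open MeasureTheory
noncomputable section

/-- One half of the second Fréchet derivative of `F²` at `v`, evaluated on `(w₁, w₂)`:
the fundamental tensor of `F`. -/
def fundTensor {V : Type*} [NormedAddCommGroup V] [NormedSpace ℝ V]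
    (F : V → ℝ) (v w₁ w₂ : V) : ℝ :=
  (1 / 2) * fderiv ℝ (fderiv ℝ (fun u => (F u) ^ 2)) v w₁ w₂

/-- A strongly convex Minkowski norm on a real normed space. -/
structure IsMinkowskiNorm {V : Type*} [NormedAddCommGroup V] [NormedSpace ℝ V]
    (F : V → ℝ) : Prop where
  continuous : Continuous F
  map_zero : F 0 = 0
  pos : ∀ v : V, v ≠ 0 → 0 < F v
  homog : ∀ lam : ℝ, 0 < lam → ∀ v : V, F (lam • v) = lam * F v
  smooth : ContDiffOn ℝ 2 F {0}ᶜ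
  symm : ∀ v : V, v ≠ 0 → ∀ w₁ w₂ : V, fundTensor F v w₁ w₂ = fundTensor F v w₂ w₁
  posdef : ∀ v : V, v ≠ 0 → ∀ w : V, w ≠ 0 → 0 < fundTensor F v w w

/-- The Legendre map of `F`: `ℓ(v) = (1/2) D(F²)(v)` for `v ≠ 0`, and `ℓ(0) = 0`. -/
def legendre {V : Type*} [NormedAddCommGroup V] [NormedSpace ℝ V]
    (F : V → ℝ) (v : V) : V →L[ℝ] ℝ :=
  if v = 0 then 0 else (1 / 2 : ℝ) • fderiv ℝ (fun u => (F u) ^ 2) v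

/-- The dual co-Finsler norm `F^*(ω) = sup {ω v : F v = 1}`. -/
def dualNorm {V : Type*} [NormedAddCommGroup V] [NormedSpace ℝ V]
    (F : V → ℝ) (ω : V →L[ℝ] ℝ) : ℝ :=
  sSup ((fun v => ω v) '' {v | F v = 1})

/-- One half of the derivative of `F²`; away from `0` this is the Legendre map of `F`. -/
def halfDiff {V : Type*} [NormedAddCommGroup V] [NormedSpace ℝ V]
    (F : V → ℝ) (v : V) : V →L[ℝ] ℝ :=
  (1 / 2 : ℝ) • fderiv ℝ (fun u => (F u) ^ 2) v

namespace IsMinkowskiNorm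

variable {V : Type*} [NormedAddCommGroup V] [NormedSpace ℝ V] {F : V → ℝ}

theorem nonneg (hF : IsMinkowskiNorm F) (v : V) : 0 ≤ F v := by
  rcases eq_or_ne v 0 with rfl | hv
  · exact hF.map_zero.ge
  · exact (hF.pos v hv).le

theorem contDiffAt_sq (hF : IsMinkowskiNorm F) {v : V} (hv : v ≠ 0) :
    ContDiffAt ℝ 2 (fun u => (F u) ^ 2) v :=
  ((hF.smooth v hv).contDiffAt (isOpen_compl_singleton.mem_nhds hv)).pow 2

theorem hasFDerivAt_sq (hF : IsMinkowskiNorm F) {v : V} (hv : v ≠ 0) :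
    HasFDerivAt (fun u => (F u) ^ 2) ((2 : ℝ) • halfDiff F v) v := by
  rw [halfDiff, smul_smul, mul_one_div_cancel two_ne_zero, one_smul]
  exact ((hF.contDiffAt_sq hv).differentiableAt (by norm_num)).hasFDerivAt

theorem contDiffAt_halfDiff (hF : IsMinkowskiNorm F) {v : V} (hv : v ≠ 0) :
    ContDiffAt ℝ 1 (halfDiff F) v :=
  ((hF.contDiffAt_sq hv).fderiv_right (m := 1) (by norm_num)).const_smul (1 / 2 : ℝ)

theorem hasFDerivAt_halfDiff (hF : IsMinkowskiNorm F) {v : V} (hv : v ≠ 0) :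
    HasFDerivAt (halfDiff F) (fderiv ℝ (halfDiff F) v) v :=
  ((hF.contDiffAt_halfDiff hv).differentiableAt (by norm_num)).hasFDerivAt

theorem fderiv_halfDiff_apply (hF : IsMinkowskiNorm F) {v : V} (hv : v ≠ 0) (w₁ w₂ : V) :
    fderiv ℝ (halfDiff F) v w₁ w₂ = fundTensor F v w₁ w₂ := by
  have h : DifferentiableAt ℝ (fderiv ℝ (fun u => (F u) ^ 2)) v :=
    ((hF.contDiffAt_sq hv).fderiv_right (m := 1) (by norm_num)).differentiableAt (by norm_num)
  have h' : HasFDerivAt (halfDiff F)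
      ((1 / 2 : ℝ) • fderiv ℝ (fderiv ℝ (fun u => (F u) ^ 2)) v) v :=
    h.hasFDerivAt.const_smul (1 / 2 : ℝ)
  rw [h'.fderiv]
  simp [fundTensor]

theorem fundTensor_self_nonneg (hF : IsMinkowskiNorm F) {v : V} (hv : v ≠ 0) (w : V) :
    0 ≤ fundTensor F v w w := by
  rcases eq_or_ne w 0 with rfl | hw
  · simp [fundTensor]
  · exact (hF.posdef v hv w hw).le

theorem halfDiff_apply_self (hF : IsMinkowskiNorm F) {v : V} (hv : v ≠ 0) :
    halfDiff F v v = (F v) ^ 2 := by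
  have hγ : HasDerivAt (fun t : ℝ => t • v) v 1 := by
    simpa using (hasDerivAt_id (1 : ℝ)).smul_const v
  have h₁ : HasDerivAt (fun t : ℝ => (F (t • v)) ^ 2) (2 * halfDiff F v v) 1 := by
    have h := hF.hasFDerivAt_sq (v := (1 : ℝ) • v) (by simpa using hv)
    simpa [Function.comp_def] using h.comp_hasDerivAt (1 : ℝ) hγ
  have h₂ : HasDerivAt (fun t : ℝ => (F (t • v)) ^ 2) (2 * (F v) ^ 2) 1 := by
    have h : HasDerivAt (fun t : ℝ => t ^ 2 * (F v) ^ 2) (2 * (F v) ^ 2) 1 := by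
      simpa using (hasDerivAt_pow 2 (1 : ℝ)).mul_const ((F v) ^ 2)
    refine h.congr_of_eventuallyEq ?_
    filter_upwards [lt_mem_nhds (zero_lt_one' ℝ)] with t ht
    rw [hF.homog t ht, mul_pow]
  linarith [h₁.unique h₂]

theorem sq_add_two_mul_halfDiff_le (hF : IsMinkowskiNorm F) {v d : V}
    (h : ∀ t ∈ Set.Icc (0 : ℝ) 1, v + t • d ≠ 0) :
    (F v) ^ 2 + 2 * halfDiff F v d ≤ (F (v + d)) ^ 2 := by
  have hγ : ∀ t : ℝ, HasDerivAt (fun t : ℝ => v + t • d) d t := fun t => by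
    simpa using ((hasDerivAt_id t).smul_const d).const_add v
  have h₁ : ∀ t ∈ Set.Icc (0 : ℝ) 1, HasDerivAt (fun t : ℝ => (F (v + t • d)) ^ 2)
      (2 * halfDiff F (v + t • d) d) t := fun t ht => by
    simpa [Function.comp_def] using (hF.hasFDerivAt_sq (h t ht)).comp_hasDerivAt t (hγ t)
  have h₂ : ∀ t ∈ Set.Icc (0 : ℝ) 1, HasDerivAt (fun t : ℝ => halfDiff F (v + t • d) d)
      (fundTensor F (v + t • d) d d) t := fun t ht => by
    rw [← hF.fderiv_halfDiff_apply (h t ht)]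
    have := (hF.hasFDerivAt_halfDiff (h t ht)).comp_hasDerivAt t (hγ t)
    simpa using this.clm_apply (hasDerivAt_const t d)
  obtain ⟨ξ, hξ, hξ'⟩ := exists_hasDerivAt_eq_slope _ _ zero_lt_one
    (fun t ht => (h₁ t ht).continuousAt.continuousWithinAt)
    (fun t ht => h₁ t (Set.Ioo_subset_Icc_self ht))
  obtain ⟨ζ, hζ, hζ'⟩ := exists_hasDerivAt_eq_slope _ _ hξ.1
    (fun t ht => (h₂ t ⟨ht.1, ht.2.trans hξ.2.le⟩).continuousAt.continuousWithinAt)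
    (fun t ht => h₂ t ⟨ht.1.le, ht.2.le.trans hξ.2.le⟩)
  have hpos := hF.fundTensor_self_nonneg (h ζ ⟨hζ.1.le, hζ.2.le.trans hξ.2.le⟩) d
  rw [hζ', sub_zero, le_div_iff₀ hξ.1] at hpos
  simp only [zero_smul, one_smul, add_zero, sub_zero, div_one] at hξ' hpos
  linarith

/-- The fundamental inequality. -/
theorem halfDiff_apply_le (hF : IsMinkowskiNorm F) {v : V} (hv : v ≠ 0) (w : V) :
    halfDiff F v w ≤ F v * F w := by
  rcases eq_or_ne w 0 with rfl | hw
  · simp [hF.map_zero]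
  have hFv := hF.pos v hv
  have hFw := hF.pos w hw
  by_cases h : ∀ t ∈ Set.Icc (0 : ℝ) 1, v + t • ((F v / F w) • w - v) ≠ 0
  · have key := hF.sq_add_two_mul_halfDiff_le h
    rw [add_sub_cancel, hF.homog _ (div_pos hFv hFw), div_mul_cancel₀ _ hFw.ne', map_sub,
      hF.halfDiff_apply_self hv, map_smul, smul_eq_mul] at key
    have : F v / F w * halfDiff F v w ≤ F v / F w * (F v * F w) := by
      have : F v / F w * (F v * F w) = F v ^ 2 := by field_simp
      linarith
    exact le_of_mul_le_mul_left this (div_pos hFv hFw)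
  · push Not at h
    obtain ⟨t, ht, h0⟩ := h
    have h1 := congrArg (halfDiff F v) h0
    simp only [map_add, map_smul, map_sub, smul_eq_mul,
      hF.halfDiff_apply_self hv] at h1
    rw [_root_.map_zero] at h1
    have h2 : t * (F v / F w) * halfDiff F v w ≤ 0 := by
      nlinarith [ht.2, sq_nonneg (F v)]
    have ht0 : 0 < t := by
      refine ht.1.lt_of_ne fun h => ?_
      subst h
      simp at h1
      exact hFv.ne' h1
    have h3 : halfDiff F v w ≤ 0 :=
      nonpos_of_mul_nonpos_right h2 (mul_pos ht0 (div_pos hFv hFw))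
    exact h3.trans (by positivity)

theorem map_inv_smul_self (hF : IsMinkowskiNorm F) {v : V} (hv : v ≠ 0) :
    F ((F v)⁻¹ • v) = 1 := by
  have h := hF.pos v hv
  rw [hF.homog _ (inv_pos.2 h), inv_mul_cancel₀ h.ne']

theorem dualNorm_zero : dualNorm F 0 = 0 := by
  refine le_antisymm (Real.sSup_le ?_ le_rfl) (Real.sSup_nonneg ?_) <;>
  · rintro _ ⟨v, -, rfl⟩
    simp

theorem dualNorm_smul {lam : ℝ} (h : 0 ≤ lam) (ω : V →L[ℝ] ℝ) :
    dualNorm F (lam • ω) = lam * dualNorm F ω := by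
  rw [dualNorm, dualNorm, ← smul_eq_mul, ← Real.sSup_smul_of_nonneg h, ← Set.image_smul,
    Set.image_image]
  rfl

variable [FiniteDimensional ℝ V]

theorem exists_norm_le (hF : IsMinkowskiNorm F) : ∃ C : ℝ, 0 < C ∧ ∀ v, ‖v‖ ≤ C * F v := by
  rcases subsingleton_or_nontrivial V with _ | _
  · exact ⟨1, one_pos, fun v => by simp [Subsingleton.elim v 0, hF.map_zero]⟩
  have : ProperSpace V := FiniteDimensional.proper ℝ V
  obtain ⟨u, hu, hmin⟩ := (isCompact_sphere (0 : V) 1).exists_isMinOn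
    (NormedSpace.sphere_nonempty.2 zero_le_one) hF.continuous.continuousOn
  have hu0 : 0 < F u := hF.pos u (ne_zero_of_mem_unit_sphere ⟨u, hu⟩)
  refine ⟨(F u)⁻¹, inv_pos.2 hu0, fun v => ?_⟩
  rcases eq_or_ne v 0 with rfl | hv
  · simp [hF.map_zero]
  have hv' : 0 < ‖v‖ := norm_pos_iff.2 hv
  have h : F u ≤ F (‖v‖⁻¹ • v) := hmin (by simp [norm_smul, hv'.ne'])
  rw [hF.homog _ (inv_pos.2 hv'), inv_mul_eq_div, le_div_iff₀ hv'] at h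
  rwa [inv_mul_eq_div, le_div_iff₀ hu0, mul_comm]

theorem isCompact_indicatrix (hF : IsMinkowskiNorm F) : IsCompact {v | F v = 1} := by
  have : ProperSpace V := FiniteDimensional.proper ℝ V
  obtain ⟨C, -, hC⟩ := hF.exists_norm_le
  refine (isCompact_closedBall (0 : V) C).of_isClosed_subset
    (isClosed_eq hF.continuous continuous_const) fun v hv => ?_
  have h := hC v
  rw [show F v = 1 from hv, mul_one] at h
  simpa using h

theorem apply_le_dualNorm (hF : IsMinkowskiNorm F) (ω : V →L[ℝ] ℝ) {v : V} (hv : F v = 1) :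
    ω v ≤ dualNorm F ω :=
  le_csSup (hF.isCompact_indicatrix.image ω.continuous).bddAbove ⟨v, hv, rfl⟩

theorem apply_le_dualNorm_mul (hF : IsMinkowskiNorm F) (ω : V →L[ℝ] ℝ) (v : V) :
    ω v ≤ dualNorm F ω * F v := by
  rcases eq_or_ne v 0 with rfl | hv
  · simp [hF.map_zero]
  have h := hF.apply_le_dualNorm ω (hF.map_inv_smul_self hv)
  rwa [map_smul, smul_eq_mul, inv_mul_eq_div, div_le_iff₀ (hF.pos v hv)] at h

theorem dualNorm_halfDiff (hF : IsMinkowskiNorm F) {v : V} (hv : v ≠ 0) :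
    dualNorm F (halfDiff F v) = F v := by
  have hFv := hF.pos v hv
  refine le_antisymm (csSup_le ⟨_, _, hF.map_inv_smul_self hv, rfl⟩ ?_) ?_
  · rintro _ ⟨w, hw, rfl⟩
    have h := hF.halfDiff_apply_le hv w
    rwa [show F w = 1 from hw, mul_one] at h
  · have h := hF.apply_le_dualNorm_mul (halfDiff F v) v
    rw [hF.halfDiff_apply_self hv, sq] at h
    exact le_of_mul_le_mul_right h hFv

theorem exists_halfDiff_eq (hF : IsMinkowskiNorm F) {ω : V →L[ℝ] ℝ} (hω : ω ≠ 0) :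
    ∃ v, v ≠ 0 ∧ halfDiff F v = ω := by
  obtain ⟨x, hx⟩ : ∃ x, 0 < ω x := by
    obtain ⟨x, hx⟩ := DFunLike.ne_iff.1 hω
    rcases lt_or_gt_of_ne hx with h | h
    · exact ⟨-x, by simpa using h⟩
    · exact ⟨x, by simpa using h⟩
  have hx0 : x ≠ 0 := by
    rintro rfl
    simp at hx
  obtain ⟨u, hu, hmax⟩ := hF.isCompact_indicatrix.exists_isMaxOn
    ⟨_, hF.map_inv_smul_self hx0⟩ ω.continuous.continuousOn
  replace hu : F u = 1 := hu
  have hle : ∀ v, ω v ≤ ω u * F v := fun v => by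
    rcases eq_or_ne v 0 with rfl | hv
    · simp [hF.map_zero]
    have h : ω ((F v)⁻¹ • v) ≤ ω u := hmax (hF.map_inv_smul_self hv)
    rwa [map_smul, smul_eq_mul, inv_mul_eq_div, div_le_iff₀ (hF.pos v hv)] at h
  have hM : 0 < ω u := pos_of_mul_pos_left (hx.trans_le (hle x)) (hF.nonneg x)
  have hu0 : u ≠ 0 := by
    rintro rfl
    simp at hM
  have hv0 : ω u • u ≠ 0 := smul_ne_zero hM.ne' hu0
  refine ⟨ω u • u, hv0, ?_⟩
  have hmin : IsLocalMin (fun v => (F v) ^ 2 - (2 : ℝ) • ω v) (ω u • u) := by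
    refine Filter.Eventually.of_forall fun v => ?_
    simp only [hF.homog _ hM, hu, map_smul, smul_eq_mul]
    nlinarith [sq_nonneg (F v - ω u), hle v]
  have hd := hmin.hasFDerivAt_eq_zero
    ((hF.hasFDerivAt_sq hv0).sub (ω.hasFDerivAt.const_smul (2 : ℝ)))
  rw [← smul_sub, smul_eq_zero] at hd
  exact sub_eq_zero.1 (hd.resolve_left two_ne_zero)

/-- The fundamental tensor at `v ≠ 0`, as an isomorphism onto the dual space. -/
theorem exists_fderiv_halfDiff_equiv (hF : IsMinkowskiNorm F) {v : V} (hv : v ≠ 0) :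
    ∃ e : V ≃L[ℝ] (V →L[ℝ] ℝ), (e : V →L[ℝ] (V →L[ℝ] ℝ)) = fderiv ℝ (halfDiff F) v := by
  have hinj : Function.Injective (fderiv ℝ (halfDiff F) v).toLinearMap := by
    refine (injective_iff_map_eq_zero _).2 fun w hw => ?_
    by_contra hw0
    have h := hF.posdef v hv w hw0
    rw [← hF.fderiv_halfDiff_apply hv] at h
    have h' : fderiv ℝ (halfDiff F) v w = 0 := hw
    simp [h'] at h
  have hrank : Module.finrank ℝ V = Module.finrank ℝ (V →L[ℝ] ℝ) := by
    rw [← (LinearMap.toContinuousLinearMap (𝕜 := ℝ) (E := V) (F' := ℝ)).finrank_eq]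
    exact (Subspace.dual_finrank_eq (K := ℝ) (V := V)).symm
  refine ⟨(LinearEquiv.ofInjectiveOfFinrankEq _ hinj hrank).toContinuousLinearEquiv, ?_⟩
  ext w : 1
  exact LinearMap.congr_fun (LinearEquiv.coe_ofInjectiveOfFinrankEq _ hinj hrank) w

/-- Near `ω = halfDiff F v` the map `halfDiff F` has a `C¹` right inverse `σ`. -/
theorem exists_local_inverse (hF : IsMinkowskiNorm F) {v : V} (hv : v ≠ 0) :
    ∃ σ : (V →L[ℝ] ℝ) → V, σ (halfDiff F v) = v ∧ ContDiffAt ℝ 1 σ (halfDiff F v) ∧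
      ∀ᶠ η in 𝓝 (halfDiff F v), halfDiff F (σ η) = η := by
  have : CompleteSpace V := FiniteDimensional.complete ℝ V
  obtain ⟨e, he⟩ := hF.exists_fderiv_halfDiff_equiv hv
  have hd : HasFDerivAt (halfDiff F) (e : V →L[ℝ] (V →L[ℝ] ℝ)) v :=
    he ▸ hF.hasFDerivAt_halfDiff hv
  have hc := hF.contDiffAt_halfDiff hv
  exact ⟨hc.localInverse hd one_ne_zero, hc.localInverse_apply_image hd one_ne_zero,
    hc.to_localInverse hd one_ne_zero,
    (hc.hasStrictFDerivAt' hd one_ne_zero).eventually_right_inverse⟩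

/-- Near `ω = halfDiff F v` the derivative of `(F^*)²` is twice evaluation at `σ`. -/
theorem exists_hasFDerivAt_dualNorm_sq (hF : IsMinkowskiNorm F) {v : V} (hv : v ≠ 0) :
    ∃ σ : (V →L[ℝ] ℝ) → V, σ (halfDiff F v) = v ∧ ContDiffAt ℝ 1 σ (halfDiff F v) ∧
      (∀ᶠ η in 𝓝 (halfDiff F v), halfDiff F (σ η) = η) ∧
      ∀ᶠ η in 𝓝 (halfDiff F v), HasFDerivAt (fun ω => (dualNorm F ω) ^ 2)
        (((2 : ℝ) • ContinuousLinearMap.apply ℝ ℝ (E := V)) (σ η)) η := by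
  obtain ⟨σ, hσv, hσ, hr⟩ := hF.exists_local_inverse hv
  refine ⟨σ, hσv, hσ, hr, ?_⟩
  have hne : ∀ᶠ η in 𝓝 (halfDiff F v), σ η ≠ 0 :=
    hσ.continuousAt.eventually_ne (by rwa [hσv])
  have hdiff : ∀ᶠ η in 𝓝 (halfDiff F v), DifferentiableAt ℝ σ η :=
    (hσ.eventually (by simp)).mono fun η h => h.differentiableAt (by norm_num)
  filter_upwards [hr.eventually_nhds, hne.eventually_nhds, hdiff] with η hrη hneη hdη
  have hsq : (fun ω => (dualNorm F ω) ^ 2) =ᶠ[𝓝 η] fun ω => (F (σ ω)) ^ 2 := by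
    filter_upwards [hrη, hneη] with ω h h0
    rw [← hF.dualNorm_halfDiff h0, h]
  have happ : (fun ω => (dualNorm F ω) ^ 2) =ᶠ[𝓝 η] fun ω => ω (σ ω) := by
    filter_upwards [hsq, hrη, hneη] with ω h h' h0
    rw [h, ← hF.halfDiff_apply_self h0, h']
  have h₁ := ((hF.hasFDerivAt_sq hneη.self_of_nhds).comp η hdη.hasFDerivAt).congr_of_eventuallyEq
    hsq
  have h₂ := ((hasFDerivAt_id η).clm_apply hdη.hasFDerivAt).congr_of_eventuallyEq happ
  have h : ((2 : ℝ) • ContinuousLinearMap.apply ℝ ℝ (E := V) : V →L[ℝ] _) (σ η) =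
      ((2 : ℝ) • halfDiff F (σ η)) ∘L fderiv ℝ σ η := by
    ext ζ
    have hζ := DFunLike.congr_fun (h₁.unique h₂) ζ
    simp [hrη.self_of_nhds] at hζ ⊢
    linarith
  rw [h]
  exact h₁

theorem contDiffAt_dualNorm_sq (hF : IsMinkowskiNorm F) {ω : V →L[ℝ] ℝ} (hω : ω ≠ 0) :
    ContDiffAt ℝ 2 (fun η => (dualNorm F η) ^ 2) ω := by
  obtain ⟨v, hv, rfl⟩ := hF.exists_halfDiff_eq hω
  obtain ⟨σ, -, hσ, -, hd⟩ := hF.exists_hasFDerivAt_dualNorm_sq hv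
  refine (contDiffAt_succ_iff_hasFDerivAt (n := 1)).2
    ⟨_, ⟨_, hd, fun _ h => h⟩, ?_⟩
  exact hσ.continuousLinearMap_comp (G := (V →L[ℝ] ℝ) →L[ℝ] ℝ)
    ((2 : ℝ) • ContinuousLinearMap.apply ℝ ℝ (E := V))

theorem fundTensor_dualNorm_pos (hF : IsMinkowskiNorm F) {ω : V →L[ℝ] ℝ} (hω : ω ≠ 0)
    {η : V →L[ℝ] ℝ} (hη : η ≠ 0) : 0 < fundTensor (dualNorm F) ω η η := by
  obtain ⟨v, hv, rfl⟩ := hF.exists_halfDiff_eq hω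
  obtain ⟨σ, hσv, hσ, hr, hd⟩ := hF.exists_hasFDerivAt_dualNorm_sq hv
  have hσ' := (hσ.differentiableAt (by norm_num)).hasFDerivAt
  have hfd : fderiv ℝ (fun ω => (dualNorm F ω) ^ 2) =ᶠ[𝓝 (halfDiff F v)]
      fun η => ((2 : ℝ) • ContinuousLinearMap.apply ℝ ℝ (E := V)) (σ η) := hd.mono fun _ h => h.fderiv
  have hsnd := (((2 : ℝ) • ContinuousLinearMap.apply ℝ ℝ (E := V)).hasFDerivAt.comp _
    hσ').congr_of_eventuallyEq hfd
  obtain ⟨w, hw⟩ : ∃ w, fderiv ℝ σ (halfDiff F v) η = w := ⟨_, rfl⟩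
  have hη' : fderiv ℝ (halfDiff F) v w = η := by
    have hd' : HasFDerivAt (halfDiff F) (fderiv ℝ (halfDiff F) v) (σ (halfDiff F v)) := by
      rw [hσv]
      exact hF.hasFDerivAt_halfDiff hv
    have h := (hd'.comp _ hσ').unique ((hasFDerivAt_id _).congr_of_eventuallyEq hr)
    rw [← hw]
    exact DFunLike.congr_fun h η
  have hw0 : w ≠ 0 := by
    rintro rfl
    exact hη (by rw [← hη', _root_.map_zero])
  have hval : fundTensor (dualNorm F) (halfDiff F v) η η = η w := by
    rw [fundTensor, hsnd.fderiv]
    simp [hw]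
  rw [hval, ← hη', hF.fderiv_halfDiff_apply hv]
  exact hF.posdef v hv w hw0

theorem dualNorm_pos (hF : IsMinkowskiNorm F) {ω : V →L[ℝ] ℝ} (hω : ω ≠ 0) :
    0 < dualNorm F ω := by
  obtain ⟨v, hv, rfl⟩ := hF.exists_halfDiff_eq hω
  rw [hF.dualNorm_halfDiff hv]
  exact hF.pos v hv

theorem contDiffAt_dualNorm (hF : IsMinkowskiNorm F) {ω : V →L[ℝ] ℝ} (hω : ω ≠ 0) :
    ContDiffAt ℝ 2 (dualNorm F) ω := by
  refine ((hF.contDiffAt_dualNorm_sq hω).sqrt (pow_pos (hF.dualNorm_pos hω) 2).ne')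
    |>.congr_of_eventuallyEq ?_
  filter_upwards [isOpen_ne.mem_nhds hω] with η hη
  rw [Real.sqrt_sq (hF.dualNorm_pos hη).le]

theorem continuousAt_dualNorm_zero (hF : IsMinkowskiNorm F) : ContinuousAt (dualNorm F) 0 := by
  obtain ⟨C, hC0, hC⟩ := hF.exists_norm_le
  have hlim : Filter.Tendsto (fun ω : V →L[ℝ] ℝ => ‖ω‖ * C) (𝓝 0) (𝓝 0) := by
    simpa using ((continuous_norm (E := V →L[ℝ] ℝ)).mul_const C).tendsto 0
  rw [ContinuousAt, dualNorm_zero]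
  refine squeeze_zero (fun ω => ?_) (fun ω => ?_) hlim
  · rcases eq_or_ne ω 0 with rfl | hω
    · exact dualNorm_zero.ge
    · exact (hF.dualNorm_pos hω).le
  · refine Real.sSup_le ?_ (by positivity)
    rintro _ ⟨v, hv, rfl⟩
    have h := hC v
    rw [show F v = 1 from hv, mul_one] at h
    exact (le_abs_self _).trans ((ω.le_opNorm v).trans (by gcongr))

/-- The dual of a strongly convex Minkowski norm is a strongly convex Minkowski norm. -/
theorem isMinkowskiNorm_dualNorm (hF : IsMinkowskiNorm F) : IsMinkowskiNorm (dualNorm F) where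
  continuous := continuous_iff_continuousAt.2 fun ω => by
    rcases eq_or_ne ω 0 with rfl | hω
    · exact hF.continuousAt_dualNorm_zero
    · exact (hF.contDiffAt_dualNorm hω).continuousAt
  map_zero := dualNorm_zero
  pos _ hω := hF.dualNorm_pos hω
  homog _ h ω := dualNorm_smul h.le ω
  smooth _ hω := (hF.contDiffAt_dualNorm hω).contDiffWithinAt
  symm ω hω η₁ η₂ := by
    have h := (hF.contDiffAt_dualNorm_sq hω).isSymmSndFDerivAt (by simp)
    rw [fundTensor, fundTensor, h.eq]
  posdef _ hω _ hη := hF.fundTensor_dualNorm_pos hω hη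

end IsMinkowskiNorm

/-- for a `C³` strongly convex Minkowski norm `F`, the fundamental tensor
of the dual norm `F^*` is positive definite at every `ω ≠ 0`; indeed `F^*` is itself a
strongly convex Minkowski norm on the dual space. -/
theorem dualNorm_is_strongly_convex
    {m : ℕ} (hm : 2 ≤ m) (F : EuclideanSpace ℝ (Fin m) → ℝ)
    (hF : IsMinkowskiNorm F)
    (hsm : ContDiffOn ℝ 3 F ({0}ᶜ : Set (EuclideanSpace ℝ (Fin m)))) :
    (∀ ω : EuclideanSpace ℝ (Fin m) →L[ℝ] ℝ, ω ≠ 0 →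
      ∀ η : EuclideanSpace ℝ (Fin m) →L[ℝ] ℝ, η ≠ 0 →
        0 < fundTensor (dualNorm F) ω η η) ∧
    IsMinkowskiNorm (dualNorm F) := by
  exact ⟨fun _ hω _ hη => hF.fundTensor_dualNorm_pos hω hη, hF.isMinkowskiNorm_dualNorm⟩
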